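/- For every θ ∈ ℝ, the triple s = (√q·e^{iθ}, e^{−2iθ}, e^{iθ}/√q) lies in S and has pairwise distinct entries, and it satisfies: (i) for every ε ∈ (0,1/2), ‖f_s^ε‖²_w < ∞; and (ii) lim_{ε→0⁺} ‖A_w^+ f_s^ε − λ⁺ f_s^ε‖_w / ‖f_s^ε‖_w = 0 and lim_{ε→0⁺} ‖A_w^− f_s^ε − λ⁻ f_s^ε‖_w / ‖f_s^ε‖_w = 0, where λ⁺ = q^{3/2}e^{iθ} + q e^{−2iθ} + q^{1/2}e^{iθ} and λ⁻ = conj(λ⁺). -/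

import Mathlib

set_option linter.unusedSectionVars false

noncomputable section

open Filter

/-- The index set `V = {(m,n) ∈ ℕ × ℕ : n ≤ m}` of vertices `v_{m,n}` of the quotient
complex. -/
def Vtx : Type := {p : ℕ × ℕ // p.2 ≤ p.1}

/-- The weight `w(v_{m,n})`. -/
def wt (q : ℕ) (p : ℕ × ℕ) : ℝ :=
  if p.1 = 0 then 1 / ((q : ℝ)^2 + q + 1)
  else if p.2 = 0 ∨ p.2 = p.1 then 1 / (q : ℝ)^(2 * p.1)
  else ((q : ℝ) + 1) / (q : ℝ)^(2 * p.1)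

/-- The weighted adjacency operator `A_w^+`. -/
def Aplus (q : ℕ) (f : ℕ → ℕ → ℂ) : ℕ → ℕ → ℂ := fun m n =>
  if m = 0 then ((q : ℂ)^2 + q + 1) * f 1 0
  else if n = 0 then f (m+1) 0 + ((q : ℂ)^2 + q) * f m 1
  else if n = m then (q : ℂ)^2 * f (m-1) (m-1) + ((q : ℂ) + 1) * f (m+1) m
  else (q : ℂ)^2 * f (m-1) (n-1) + (q : ℂ) * f m (n+1) + f (m+1) n

/-- The weighted adjacency operator `A_w^-`. -/
def Aminus (q : ℕ) (f : ℕ → ℕ → ℂ) : ℕ → ℕ → ℂ := fun m n =>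
  if m = 0 then ((q : ℂ)^2 + q + 1) * f 1 1
  else if n = 0 then (q : ℂ)^2 * f (m-1) 0 + ((q : ℂ) + 1) * f (m+1) 1
  else if n = m then ((q : ℂ)^2 + q) * f m (m-1) + f (m+1) (m+1)
  else (q : ℂ)^2 * f (m-1) n + (q : ℂ) * f m (n-1) + f (m+1) (n+1)

/-- The squared weighted `L²` norm `‖f‖²_w = Σ_{(m,n) ∈ V} |f(v_{m,n})|² w(v_{m,n})`. -/
def normSqW (q : ℕ) (f : ℕ → ℕ → ℂ) : ℝ :=
  ∑' p : Vtx, ‖f p.1.1 p.1.2‖^2 * wt q p.1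

/-- `f ∈ L²_w`: the defining sum of `‖f‖²_w` is finite (summable). -/
def MemL2 (q : ℕ) (f : ℕ → ℕ → ℂ) : Prop :=
  Summable fun p : Vtx => ‖f p.1.1 p.1.2‖^2 * wt q p.1

/-- `f` is a simultaneous `(λ⁺,λ⁻)`-eigenfunction of `A_w^+` and `A_w^-`. -/
def IsEigen (q : ℕ) (f : ℕ → ℕ → ℂ) (lp lm : ℂ) : Prop :=
  ∀ m n : ℕ, n ≤ m → Aplus q f m n = lp * f m n ∧ Aminus q f m n = lm * f m n

/-- The coefficient `B_{i,j}` (with arguments `(s_i, s_j, s_k)`). -/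
def Bc (q : ℕ) (si sj sk : ℂ) : ℂ :=
  ((si - q * sj) * (si - q * sk) * (sj - q * sk)) /
    ((si - sj) * (si - sk) * (sj - sk) * ((q : ℂ) + 1) * ((q : ℂ)^2 + q + 1))

/-- The eigenfunction `f_s(v_{m,n}) = Σ_{(i,j), i ≠ j} B_{i,j} q^m s_i^m s_j^n`. -/
def fs (q : ℕ) (s1 s2 s3 : ℂ) : ℕ → ℕ → ℂ := fun m n =>
  Bc q s1 s2 s3 * (q : ℂ)^m * s1^m * s2^n + Bc q s1 s3 s2 * (q : ℂ)^m * s1^m * s3^n +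
  Bc q s2 s1 s3 * (q : ℂ)^m * s2^m * s1^n + Bc q s2 s3 s1 * (q : ℂ)^m * s2^m * s3^n +
  Bc q s3 s1 s2 * (q : ℂ)^m * s3^m * s1^n + Bc q s3 s2 s1 * (q : ℂ)^m * s3^m * s2^n

/-- The damped function `f_s^ε(v_{m,n}) = (1-ε)^m f_s(v_{m,n})`. -/
def fse (q : ℕ) (s1 s2 s3 : ℂ) (ε : ℝ) : ℕ → ℕ → ℂ := fun m n =>
  ((1 - ε : ℝ) : ℂ)^m * fs q s1 s2 s3 m n

lemma wt_lower (q : ℕ) (hq : 2 ≤ q) (p : ℕ × ℕ) :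
    1 / ((q : ℝ)^2 + q + 1) / (q : ℝ)^(2 * p.1) ≤ wt q p := by
  have h2 : (2 : ℝ) ≤ q := by exact_mod_cast hq
  have hp : (0 : ℝ) < (q : ℝ)^(2 * p.1) := by positivity
  have h1 : 1 / ((q : ℝ)^2 + q + 1) ≤ 1 := by
    rw [div_le_one (by positivity)]; nlinarith
  unfold wt
  split_ifs with h h'
  · rw [h]; simp
  · gcongr
  · gcongr
    linarith

lemma wt_upper (q : ℕ) (hq : 2 ≤ q) (p : ℕ × ℕ) :
    wt q p ≤ ((q : ℝ) + 1) / (q : ℝ)^(2 * p.1) := by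
  have h2 : (2 : ℝ) ≤ q := by exact_mod_cast hq
  have hp : (0 : ℝ) < (q : ℝ)^(2 * p.1) := by positivity
  have h1 : 1 / ((q : ℝ)^2 + q + 1) ≤ 1 := by
    rw [div_le_one (by positivity)]; nlinarith
  unfold wt
  split_ifs with h h'
  · rw [h]; simp only [mul_zero, pow_zero, div_one]; linarith
  · gcongr
    linarith
  · exact le_rfl

lemma wt_nonneg (q : ℕ) (hq : 2 ≤ q) (p : ℕ × ℕ) : 0 ≤ wt q p :=
  le_trans (by positivity) (wt_lower q hq p)

/-- The comparison constant for the weights of neighbouring vertices. -/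
def Kc (q : ℕ) : ℝ := ((q : ℝ) + 1) * ((q : ℝ)^2 + q + 1) * (q : ℝ)^2

lemma wt_compare (q : ℕ) (hq : 2 ≤ q) (p p' : ℕ × ℕ) (h : p'.1 ≤ p.1 + 1) :
    wt q p ≤ Kc q * wt q p' := by
  have h2 : (2 : ℝ) ≤ q := by exact_mod_cast hq
  have hp : (0 : ℝ) < (q : ℝ)^(2 * p.1) := by positivity
  have hp' : (0 : ℝ) < (q : ℝ)^(2 * p'.1) := by positivity
  have hle : (q : ℝ)^(2 * p'.1) ≤ (q : ℝ)^2 * (q : ℝ)^(2 * p.1) := by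
    rw [← pow_add]
    exact pow_le_pow_right₀ (by linarith) (by omega)
  calc wt q p ≤ ((q : ℝ) + 1) / (q : ℝ)^(2 * p.1) := wt_upper q hq p
    _ ≤ Kc q * (1 / ((q : ℝ)^2 + q + 1) / (q : ℝ)^(2 * p'.1)) := by
      have : Kc q * (1 / ((q : ℝ)^2 + q + 1) / (q : ℝ)^(2 * p'.1))
          = ((q : ℝ) + 1) * (q : ℝ)^2 / (q : ℝ)^(2 * p'.1) := by
        unfold Kc
        have : (q : ℝ)^2 + q + 1 ≠ 0 := by positivity
        field_simp
      rw [this, div_le_div_iff₀ hp hp']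
      have : (0 : ℝ) ≤ (q : ℝ) + 1 := by linarith
      nlinarith [mul_le_mul_of_nonneg_left hle this]
    _ ≤ _ := by
      apply mul_le_mul_of_nonneg_left (wt_lower q hq p')
      unfold Kc; positivity

lemma defect_bound (q : ℕ) (hq : 2 ≤ q) (g D : ℕ → ℕ → ℂ) (e1 e2 : Vtx → Vtx) (δ : ℝ)
    (he1 : Function.Injective e1) (he2 : Function.Injective e2)
    (h1 : ∀ p, (e1 p).1.1 ≤ p.1.1 + 1 ∧ p.1.1 ≤ (e1 p).1.1 + 1)
    (h2 : ∀ p, (e2 p).1.1 ≤ p.1.1 + 1)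
    (hg : MemL2 q g)
    (hD : ∀ p : Vtx, (∃ p', e1 p' = p ∧
        ‖D p.1.1 p.1.2‖ ≤ δ * (‖g p'.1.1 p'.1.2‖ + ‖g (e2 p).1.1 (e2 p).1.2‖)) ∨
      (‖D p.1.1 p.1.2‖ ≤ δ * ‖g (e2 p).1.1 (e2 p).1.2‖)) :
    normSqW q D ≤ 4 * Kc q * δ ^ 2 * normSqW q g := by
  classical
  set G : Vtx → ℝ := fun p => ‖g p.1.1 p.1.2‖^2 * wt q p.1 with hG
  have hG0 : ∀ p, 0 ≤ G p := fun p => mul_nonneg (by positivity) (wt_nonneg q hq _)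
  have hGs : Summable G := hg
  set H : Vtx → ℝ := Function.extend e1 G 0 with hH
  have hHs : HasSum H (∑' p, G p) := (hasSum_extend_zero he1).2 hGs.hasSum
  have hH0 : ∀ p, 0 ≤ H p := by
    intro p
    by_cases h : ∃ p', e1 p' = p
    · obtain ⟨p', rfl⟩ := h
      rw [hH, he1.extend_apply]; exact hG0 _
    · rw [hH, Function.extend_apply' _ _ _ h]; simp
  have hG2 : Summable (fun p => G (e2 p)) := hGs.comp_injective he2
  have hG2le : ∑' p, G (e2 p) ≤ ∑' p, G p := by
    exact hG2.tsum_le_tsum_of_inj e2 he2 (fun c _ => hG0 c) (fun i => le_rfl) hGs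
  have hK : 0 ≤ Kc q := by unfold Kc; positivity
  have hpt : ∀ p : Vtx, ‖D p.1.1 p.1.2‖^2 * wt q p.1 ≤
      2 * Kc q * δ^2 * (H p + G (e2 p)) := by
    intro p
    have hw0 := wt_nonneg q hq p.1
    have hw2 := wt_compare q hq p.1 (e2 p).1 (h2 p)
    have hb : ‖g (e2 p).1.1 (e2 p).1.2‖^2 * wt q p.1 ≤ Kc q * G (e2 p) := by
      calc _ ≤ ‖g (e2 p).1.1 (e2 p).1.2‖^2 * (Kc q * wt q (e2 p).1) := by gcongr
        _ = _ := by rw [hG]; ring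
    rcases hD p with ⟨p', rfl, h⟩ | h
    · have hHp : H (e1 p') = G p' := by rw [hH, he1.extend_apply]
      have ha : ‖g p'.1.1 p'.1.2‖^2 * wt q (e1 p').1 ≤ Kc q * G p' := by
        calc _ ≤ ‖g p'.1.1 p'.1.2‖^2 * (Kc q * wt q p'.1) := by
              gcongr
              exact wt_compare q hq _ _ (h1 p').2
          _ = _ := by rw [hG]; ring
      rw [hHp]
      set u := ‖g p'.1.1 p'.1.2‖
      set v := ‖g (e2 (e1 p')).1.1 (e2 (e1 p')).1.2‖
      calc _ ≤ (δ * (u + v))^2 * wt q (e1 p').1 := by gcongr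
        _ ≤ (2 * δ^2 * (u^2 + v^2)) * wt q (e1 p').1 := by
          apply mul_le_mul_of_nonneg_right _ hw0
          nlinarith [mul_nonneg (sq_nonneg δ) (sq_nonneg (u - v))]
        _ = 2 * δ^2 * (u^2 * wt q (e1 p').1 + v^2 * wt q (e1 p').1) := by ring
        _ ≤ 2 * δ^2 * (Kc q * G p' + Kc q * G (e2 (e1 p'))) := by gcongr
        _ = _ := by ring
    · set v := ‖g (e2 p).1.1 (e2 p).1.2‖
      have := hH0 p
      have := hG0 (e2 p)
      calc _ ≤ (δ * v)^2 * wt q p.1 := by gcongr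
        _ = δ^2 * (v^2 * wt q p.1) := by ring
        _ ≤ δ^2 * (Kc q * G (e2 p)) := by gcongr
        _ ≤ 2 * δ^2 * (Kc q * (H p + G (e2 p))) := by
          have : 0 ≤ δ^2 * (Kc q * G (e2 p)) := by positivity
          have : 0 ≤ δ^2 * (Kc q * H p) := by positivity
          nlinarith
        _ = _ := by ring
  have hbs : Summable (fun p => 2 * Kc q * δ^2 * (H p + G (e2 p))) :=
    (hHs.summable.add hG2).mul_left _
  have hDs : Summable (fun p : Vtx => ‖D p.1.1 p.1.2‖^2 * wt q p.1) :=
    Summable.of_nonneg_of_le (fun p => mul_nonneg (by positivity) (wt_nonneg q hq _)) hpt hbs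
  calc normSqW q D ≤ ∑' p, 2 * Kc q * δ^2 * (H p + G (e2 p)) := hDs.tsum_le_tsum hpt hbs
    _ = 2 * Kc q * δ^2 * (∑' p, G p + ∑' p, G (e2 p)) := by
      rw [tsum_mul_left, hHs.summable.tsum_add hG2, hHs.tsum_eq]
    _ ≤ 2 * Kc q * δ^2 * (∑' p, G p + ∑' p, G p) := by gcongr
    _ = 4 * Kc q * δ ^ 2 * normSqW q g := by
      have : normSqW q g = ∑' p, G p := rfl
      rw [this]; ring

/-- The shift `(m,n) ↦ (m+1,n)`. -/
def shR (p : Vtx) : Vtx := ⟨(p.1.1 + 1, p.1.2), Nat.le_succ_of_le p.2⟩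

/-- The shift `(m,n) ↦ (m+1,n+1)`. -/
def shD (p : Vtx) : Vtx := ⟨(p.1.1 + 1, p.1.2 + 1), Nat.succ_le_succ p.2⟩

lemma shR_inj : Function.Injective shR := by
  rintro ⟨⟨a, b⟩, h⟩ ⟨⟨c, d⟩, h'⟩ h2
  have h3 := congrArg (fun p : Vtx => p.1.1) h2
  have h4 := congrArg (fun p : Vtx => p.1.2) h2
  simp only [shR] at h3 h4
  apply Subtype.ext
  simp only [Prod.mk.injEq]
  omega

lemma shD_inj : Function.Injective shD := by
  rintro ⟨⟨a, b⟩, h⟩ ⟨⟨c, d⟩, h'⟩ h2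
  have h3 := congrArg (fun p : Vtx => p.1.1) h2
  have h4 := congrArg (fun p : Vtx => p.1.2) h2
  simp only [shD] at h3 h4
  apply Subtype.ext
  simp only [Prod.mk.injEq]
  omega

lemma ratio_tendsto (N M : ℝ → ℝ) (C : ℝ) (hC : 0 ≤ C)
    (h : ∀ ε ∈ Set.Ioo (0 : ℝ) (1/2), M ε ≤ C * ε^2 * N ε) :
    Filter.Tendsto (fun ε : ℝ => Real.sqrt (M ε) / Real.sqrt (N ε))
      (nhdsWithin 0 (Set.Ioi 0)) (nhds 0) := by
  have hev : ∀ᶠ ε in nhdsWithin (0 : ℝ) (Set.Ioi 0), ε ∈ Set.Ioo (0 : ℝ) (1/2) :=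
    Ioo_mem_nhdsGT (by norm_num)
  have hlim : Filter.Tendsto (fun ε : ℝ => Real.sqrt C * ε)
      (nhdsWithin 0 (Set.Ioi 0)) (nhds 0) := by
    have : Filter.Tendsto (fun ε : ℝ => Real.sqrt C * ε) (nhds 0) (nhds (Real.sqrt C * 0)) :=
      (continuous_const.mul continuous_id).tendsto 0
    rw [mul_zero] at this
    exact this.mono_left nhdsWithin_le_nhds
  refine tendsto_of_tendsto_of_tendsto_of_le_of_le' tendsto_const_nhds hlim
    (Filter.Eventually.of_forall fun ε => by positivity) ?_
  filter_upwards [hev] with ε hε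
  apply div_le_of_le_mul₀ (Real.sqrt_nonneg _)
  · exact mul_nonneg (Real.sqrt_nonneg _) hε.1.le
  · calc Real.sqrt (M ε) ≤ Real.sqrt (C * ε^2 * N ε) := Real.sqrt_le_sqrt (h ε hε)
      _ = _ := by
        rw [Real.sqrt_mul (by positivity), Real.sqrt_mul hC, Real.sqrt_sq hε.1.le]

lemma norm_comb (δ : ℝ) (x y u v : ℂ) (hx : ‖x‖ ≤ δ) (hy : ‖y‖ ≤ δ) :
    ‖x * u - y * v‖ ≤ δ * (‖u‖ + ‖v‖) := by
  calc _ ≤ ‖x * u‖ + ‖y * v‖ := norm_sub_le _ _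
    _ = ‖x‖ * ‖u‖ + ‖y‖ * ‖v‖ := by rw [norm_mul, norm_mul]
    _ ≤ δ * ‖u‖ + δ * ‖v‖ := by gcongr
    _ = _ := by ring

lemma coef_bound (q : ℕ) (ε : ℝ) (h0 : 0 < ε) (h1 : ε < 1/2) (c : ℝ) (hc : 0 ≤ c)
    (hcQ : c ≤ (q : ℝ)^2 + q + 1) :
    ‖((ε * c : ℝ) : ℂ)‖ ≤ 2 * ((q : ℝ)^2 + q + 1) * ε ∧
    ‖((ε / (1 - ε) * c : ℝ) : ℂ)‖ ≤ 2 * ((q : ℝ)^2 + q + 1) * ε := by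
  have h2 : 0 < 1 - ε := by linarith
  constructor
  · rw [Complex.norm_real, Real.norm_eq_abs, abs_of_nonneg (by positivity)]
    nlinarith [mul_le_mul_of_nonneg_left hcQ h0.le]
  · rw [Complex.norm_real, Real.norm_eq_abs, abs_of_nonneg (by positivity)]
    have : ε / (1 - ε) ≤ 2 * ε := by
      rw [div_le_iff₀ h2]; nlinarith
    calc _ ≤ 2 * ε * ((q : ℝ)^2 + q + 1) := by gcongr
      _ = _ := by ring

lemma defect_plus (q : ℕ) (hq : 2 ≤ q) (f : ℕ → ℕ → ℂ) (lp lm : ℂ) (hf : IsEigen q f lp lm)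
    (ε : ℝ) (h0 : 0 < ε) (h1 : ε < 1/2)
    (hg : MemL2 q (fun m n => ((1 - ε : ℝ) : ℂ)^m * f m n)) :
    normSqW q (fun m n => Aplus q (fun m n => ((1 - ε : ℝ) : ℂ)^m * f m n) m n
        - lp * (((1 - ε : ℝ) : ℂ)^m * f m n)) ≤
      4 * Kc q * (2 * ((q : ℝ)^2 + q + 1) * ε) ^ 2 *
        normSqW q (fun m n => ((1 - ε : ℝ) : ℂ)^m * f m n) := by
  have hr : (1 - ε) ≠ 0 := by linarith
  have hrC : (1 - (ε : ℂ)) ≠ 0 := by exact_mod_cast hr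
  have h2 : (2 : ℝ) ≤ q := by exact_mod_cast hq
  refine defect_bound q hq _ _ shD shR _ shD_inj shR_inj (fun p => ?_) (fun p => ?_) hg ?_
  · simp only [shD]; omega
  · simp only [shR]; omega
  rintro ⟨⟨m, n⟩, hmn⟩
  have he := (hf m n hmn).1
  simp only [shD, shR]
  simp only at hmn
  rcases m with _ | k
  · right
    have hn : n = 0 := by omega
    subst hn
    have hb := (coef_bound q ε h0 h1 ((q : ℝ)^2 + q + 1) (by positivity) le_rfl).2
    refine le_trans (le_of_eq ?_) (mul_le_mul_of_nonneg_right hb (norm_nonneg _))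
    rw [← norm_mul, ← norm_neg]
    congr 1
    simp only [Aplus, if_true, zero_add] at he ⊢
    push_cast
    field_simp
    linear_combination -he
  · rcases n with _ | l
    · right
      have hb := (coef_bound q ε h0 h1 1 (by positivity) (by nlinarith)).2
      refine le_trans (le_of_eq ?_) (mul_le_mul_of_nonneg_right hb (norm_nonneg _))
      rw [← norm_mul, ← norm_neg]
      congr 1
      simp only [Aplus, if_true, Nat.succ_ne_zero, if_false] at he ⊢
      push_cast
      field_simp
      linear_combination -(1 - (ε : ℂ))^(k+2) * he
    · left
      refine ⟨⟨(k, l), by simpa using hmn⟩, rfl, ?_⟩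
      have ha := (coef_bound q ε h0 h1 ((q : ℝ)^2) (by positivity) (by nlinarith)).1
      by_cases hkl : l = k
      · subst hkl
        have hb := (coef_bound q ε h0 h1 ((q : ℝ) + 1) (by positivity) (by nlinarith)).2
        refine le_trans (le_of_eq ?_) (norm_comb _ _ _ _ _ ha hb)
        congr 1
        simp only [Aplus, if_true, Nat.succ_ne_zero, if_false, Nat.add_sub_cancel] at he ⊢
        push_cast
        field_simp
        linear_combination (1 - (ε : ℂ))^(l+2) * he
      · have hb := (coef_bound q ε h0 h1 1 (by positivity) (by nlinarith)).2
        refine le_trans (le_of_eq ?_) (norm_comb _ _ _ _ _ ha hb)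
        congr 1
        simp only [Aplus, Nat.succ_ne_zero, if_false, Nat.add_sub_cancel, Nat.add_right_cancel_iff,
          hkl] at he ⊢
        push_cast
        field_simp
        linear_combination (1 - (ε : ℂ))^(k+2) * he

lemma defect_minus (q : ℕ) (hq : 2 ≤ q) (f : ℕ → ℕ → ℂ) (lp lm : ℂ) (hf : IsEigen q f lp lm)
    (ε : ℝ) (h0 : 0 < ε) (h1 : ε < 1/2)
    (hg : MemL2 q (fun m n => ((1 - ε : ℝ) : ℂ)^m * f m n)) :
    normSqW q (fun m n => Aminus q (fun m n => ((1 - ε : ℝ) : ℂ)^m * f m n) m n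
        - lm * (((1 - ε : ℝ) : ℂ)^m * f m n)) ≤
      4 * Kc q * (2 * ((q : ℝ)^2 + q + 1) * ε) ^ 2 *
        normSqW q (fun m n => ((1 - ε : ℝ) : ℂ)^m * f m n) := by
  have hr : (1 - ε) ≠ 0 := by linarith
  have hrC : (1 - (ε : ℂ)) ≠ 0 := by exact_mod_cast hr
  have h2 : (2 : ℝ) ≤ q := by exact_mod_cast hq
  refine defect_bound q hq _ _ shR shD _ shR_inj shD_inj (fun p => ?_) (fun p => ?_) hg ?_
  · simp only [shR]; omega
  · simp only [shD]; omega
  rintro ⟨⟨m, n⟩, hmn⟩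
  have he := (hf m n hmn).2
  simp only [shD, shR]
  simp only at hmn
  rcases m with _ | k
  · right
    have hn : n = 0 := by omega
    subst hn
    have hb := (coef_bound q ε h0 h1 ((q : ℝ)^2 + q + 1) (by positivity) le_rfl).2
    refine le_trans (le_of_eq ?_) (mul_le_mul_of_nonneg_right hb (norm_nonneg _))
    rw [← norm_mul, ← norm_neg]
    congr 1
    simp only [Aminus, if_true, zero_add] at he ⊢
    push_cast
    field_simp
    linear_combination -he
  · by_cases hnk : n = k + 1
    · right
      subst hnk
      have hb := (coef_bound q ε h0 h1 1 (by positivity) (by nlinarith)).2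
      refine le_trans (le_of_eq ?_) (mul_le_mul_of_nonneg_right hb (norm_nonneg _))
      rw [← norm_mul, ← norm_neg]
      congr 1
      simp only [Aminus, if_true, Nat.succ_ne_zero, if_false, Nat.add_sub_cancel] at he ⊢
      push_cast
      field_simp
      linear_combination -(1 - (ε : ℂ))^(k+2) * he
    · left
      refine ⟨⟨(k, n), by simp only; omega⟩, rfl, ?_⟩
      have ha := (coef_bound q ε h0 h1 ((q : ℝ)^2) (by positivity) (by nlinarith)).1
      by_cases hn : n = 0
      · subst hn
        have hb := (coef_bound q ε h0 h1 ((q : ℝ) + 1) (by positivity) (by nlinarith)).2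
        refine le_trans (le_of_eq ?_) (norm_comb _ _ _ _ _ ha hb)
        congr 1
        simp only [Aminus, if_true, Nat.succ_ne_zero, if_false, Nat.add_sub_cancel] at he ⊢
        push_cast
        field_simp
        linear_combination (1 - (ε : ℂ))^(k+2) * he
      · have hb := (coef_bound q ε h0 h1 1 (by positivity) (by nlinarith)).2
        refine le_trans (le_of_eq ?_) (norm_comb _ _ _ _ _ ha hb)
        congr 1
        simp only [Aminus, Nat.succ_ne_zero, if_false, Nat.add_sub_cancel, hnk, hn] at he ⊢
        push_cast
        field_simp
        linear_combination (1 - (ε : ℂ))^(k+2) * he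

/-- The three surviving terms of `f_s`. -/
def f3 (q : ℕ) (X Y Z a b c : ℂ) : ℕ → ℕ → ℂ := fun m n =>
  (q : ℂ)^m * (X * b^m * c^n + Y * c^m * a^n + Z * c^m * b^n)

lemma f3_eigen (q : ℕ) (X Y Z a b c : ℂ) (habc : a * b * c = 1) (ha : a = q * c)
    (R2 : Y * (q * a - b) + Z * (q * b - a) = 0)
    (R3 : X * (q * b - c) + Z * (q * c - b) = 0)
    (R4 : ((q : ℂ)^2 + q + 1) * (X * b + (Y + Z) * c) = (a + b + c) * (X + Y + Z))
    (R5 : ((q : ℂ)^2 + q + 1) * (X * b * c + Y * c * a + Z * c * b)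
      = (a * b + b * c + a * c) * (X + Y + Z)) :
    IsEigen q (f3 q X Y Z a b c) (q * (a + b + c)) (q * (a * b + b * c + a * c)) := by
  intro m n hmn
  rcases m with _ | k
  · have hn : n = 0 := by omega
    subst hn
    simp only [Aplus, Aminus, if_true, f3]
    constructor
    · linear_combination q * R4
    · linear_combination q * R5
  · rcases n with _ | l
    · simp only [Aplus, Aminus, if_true, Nat.succ_ne_zero, if_false, f3, Nat.add_sub_cancel]
      constructor
      · linear_combination q^(k+2) * c^(k+1) * R2 - X * q^(k+2) * b^(k+1) * ha
      · linear_combination - q^(k+2) * (X * b^k + (Y + Z) * c^k) * habc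
          - X * q^(k+2) * b^(k+2) * ha + q^(k+2) * c^(k+2) * R2
    · by_cases hkl : l = k
      · subst hkl
        simp only [Aplus, Aminus, if_true, Nat.succ_ne_zero, if_false, f3, Nat.add_sub_cancel]
        constructor
        · linear_combination
            - q^(l+2) * (X * b^l * c^l + Y * c^l * a^l + Z * c^l * b^l) * habc
            + q^(l+2) * b^(l+1) * c^(l+1) * R3 - q^(l+2) * Y * c^(l+1) * a^(l+1) * ha
        · linear_combination
            - q^(l+2) * (q + 1) * (X * b^(l+1) * c^l + Y * c^(l+1) * a^l + Z * c^(l+1) * b^l) * habc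
            + q^(l+2) * b^(l+1) * c^(l+1) * a * R3 - q^(l+2) * Y * c^(l+1) * a^(l+1) * b * ha
      · simp only [Aplus, Aminus, Nat.succ_ne_zero, if_false, f3, Nat.add_sub_cancel,
          Nat.add_right_cancel_iff, hkl]
        constructor
        · linear_combination - q^(k+2) * (X * b^k * c^l + Y * c^k * a^l + Z * c^k * b^l) * habc
        · linear_combination - q^(k+2) * (X * (b^k * c^(l+1) + b^(k+1) * c^l)
            + Y * (c^k * a^(l+1) + c^(k+1) * a^l) + Z * (c^k * b^(l+1) + c^(k+1) * b^l)) * habc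

lemma fs_eq_f3 (q : ℕ) (a b c : ℂ) (ha : a = q * c) :
    fs q a b c = f3 q (Bc q b c a) (Bc q c a b) (Bc q c b a) a b c := by
  have h1 : Bc q a b c = 0 := by simp [Bc, ha]
  have h2 : Bc q a c b = 0 := by simp [Bc, ha]
  have h3 : Bc q b a c = 0 := by simp [Bc, ha]
  funext m n
  simp only [fs, f3, h1, h2, h3]
  ring

lemma fs_eigen (q : ℕ) (a b c : ℂ) (habc : a * b * c = 1) (ha : a = q * c)
    (hab : a ≠ b) (hac : a ≠ c) (hbc : b ≠ c) :
    IsEigen q (fs q a b c) (q * (a + b + c)) (q * (a * b + b * c + a * c)) := by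
  rw [fs_eq_f3 q a b c ha]
  have e1 : (q : ℂ) + 1 ≠ 0 := by exact_mod_cast Nat.succ_ne_zero q
  have e2 : (q : ℂ)^2 + q + 1 ≠ 0 := by exact_mod_cast Nat.succ_ne_zero (q^2 + q)
  have n1 := sub_ne_zero.2 hab
  have n2 := sub_ne_zero.2 hac
  have n3 := sub_ne_zero.2 hbc
  have n1' := sub_ne_zero.2 hab.symm
  have n2' := sub_ne_zero.2 hac.symm
  have n3' := sub_ne_zero.2 hbc.symm
  -- common denominator
  set P : ℂ := (a - b) * (a - c) * (b - c) * ((q : ℂ) + 1) * ((q : ℂ)^2 + q + 1) with hP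
  have hP0 : P ≠ 0 := by rw [hP]; positivity
  have hX : Bc q b c a * P = (b - q * c) * (b - q * a) * (c - q * a) := by
    rw [hP, Bc, div_mul_eq_mul_div, div_eq_iff (by positivity)]; ring
  have hY : Bc q c a b * P = (c - q * a) * (c - q * b) * (a - q * b) := by
    rw [hP, Bc, div_mul_eq_mul_div, div_eq_iff (by positivity)]; ring
  have hZ : Bc q c b a * P = - ((c - q * b) * (c - q * a) * (b - q * a)) := by
    rw [hP, Bc, div_mul_eq_mul_div, div_eq_iff (by positivity)]; ring
  apply f3_eigen q _ _ _ a b c habc ha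
  · apply mul_right_cancel₀ hP0
    linear_combination (q * a - b) * hY + (q * b - a) * hZ
  · apply mul_right_cancel₀ hP0
    linear_combination (q * b - c) * hX + (q * c - b) * hZ
  · apply mul_right_cancel₀ hP0
    have : ((q : ℂ)^2 + q + 1) * (b * (Bc q b c a * P) + c * (Bc q c a b * P)
        + c * (Bc q c b a * P)) = (a + b + c) * (Bc q b c a * P + Bc q c a b * P
        + Bc q c b a * P) := by
      rw [hX, hY, hZ, ha]; ring
    linear_combination this
  · apply mul_right_cancel₀ hP0
    have : ((q : ℂ)^2 + q + 1) * (b * c * (Bc q b c a * P) + c * a * (Bc q c a b * P)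
        + c * b * (Bc q c b a * P)) = (a * b + b * c + a * c) * (Bc q b c a * P + Bc q c a b * P
        + Bc q c b a * P) := by
      rw [hX, hY, hZ, ha]; ring
    linear_combination this

lemma f3_mem (q : ℕ) (hq : 2 ≤ q) (X Y Z a b c : ℂ)
    (hna : ‖a‖^2 = q) (hnb : ‖b‖ = 1) (hnc : ‖c‖^2 = (q : ℝ)⁻¹)
    (ε : ℝ) (h0 : 0 < ε) (h1 : ε < 1/2) :
    MemL2 q (fun m n => ((1 - ε : ℝ) : ℂ)^m * f3 q X Y Z a b c m n) := by
  have h2 : (2 : ℝ) ≤ q := by exact_mod_cast hq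
  have hq0 : (q : ℝ) ≠ 0 := by positivity
  set ρ : ℝ := (q : ℝ)⁻¹ with hρ
  have hρ0 : 0 ≤ ρ := by positivity
  have hρ1 : ρ < 1 := inv_lt_one_of_one_lt₀ (by linarith)
  set r : ℝ := (1 - ε)^2 with hr
  have hr0 : 0 ≤ r := by positivity
  have hr1 : r < 1 := by rw [hr]; nlinarith
  have hprod : Summable (fun x : ℕ × ℕ => r^x.1 * ρ^x.2) :=
    (summable_geometric_of_lt_one hr0 hr1).mul_of_nonneg (summable_geometric_of_lt_one hρ0 hρ1)
      (fun n => by positivity) (fun n => by positivity)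
  have hS1 : Summable (fun p : Vtx => r^p.1.1 * ρ^p.1.2) :=
    hprod.comp_injective (i := fun p : Vtx => p.1) Subtype.val_injective
  have hS2 : Summable (fun p : Vtx => r^p.1.1 * ρ^(p.1.1 - p.1.2)) := by
    refine hprod.comp_injective (i := fun p : Vtx => (p.1.1, p.1.1 - p.1.2)) ?_
    rintro ⟨⟨a, b⟩, h⟩ ⟨⟨c, d⟩, h'⟩ h2
    simp only [Prod.mk.injEq] at h2 h h'
    apply Subtype.ext
    simp only [Prod.mk.injEq]
    omega
  refine Summable.of_nonneg_of_le (fun p => mul_nonneg (by positivity) (wt_nonneg q hq _)) ?_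
    (((hS1.mul_left (3 * (q + 1) * (‖X‖^2 + ‖Z‖^2))).add
      (hS2.mul_left (3 * (q + 1) * ‖Y‖^2))))
  rintro ⟨⟨m, n⟩, hmn⟩
  simp only at hmn ⊢
  have hx : ‖X * b^m * c^n‖^2 = ‖X‖^2 * ρ^n := by
    rw [norm_mul, norm_mul, norm_pow, norm_pow, hnb, ← hnc]; ring
  have hz : ‖Z * c^m * b^n‖^2 ≤ ‖Z‖^2 * ρ^n := by
    have : ‖Z * c^m * b^n‖^2 = ‖Z‖^2 * ρ^m := by
      rw [norm_mul, norm_mul, norm_pow, norm_pow, hnb, ← hnc]; ring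
    rw [this]
    exact mul_le_mul_of_nonneg_left (pow_le_pow_of_le_one hρ0 hρ1.le hmn) (by positivity)
  have hy : ‖Y * c^m * a^n‖^2 = ‖Y‖^2 * ρ^(m - n) := by
    have : ‖Y * c^m * a^n‖^2 = ‖Y‖^2 * (ρ^m * (q : ℝ)^n) := by
      rw [norm_mul, norm_mul, norm_pow, norm_pow, ← hna, ← hnc]; ring
    rw [this]
    obtain ⟨d, rfl⟩ := Nat.exists_eq_add_of_le hmn
    rw [Nat.add_sub_cancel_left, pow_add]
    have : ρ^n * (q : ℝ)^n = 1 := by rw [← mul_pow, hρ, inv_mul_cancel₀ hq0, one_pow]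
    linear_combination ‖Y‖^2 * ρ^d * this
  have hsum : ‖X * b^m * c^n + Y * c^m * a^n + Z * c^m * b^n‖^2 ≤
      3 * ((‖X‖^2 + ‖Z‖^2) * ρ^n + ‖Y‖^2 * ρ^(m-n)) := by
    rw [← hy]
    have hx' := hx.le
    set u := X * b^m * c^n
    set v := Y * c^m * a^n
    set w := Z * c^m * b^n
    have : ‖u + v + w‖ ≤ ‖u‖ + ‖v‖ + ‖w‖ := norm_add₃_le
    have : ‖u + v + w‖^2 ≤ (‖u‖ + ‖v‖ + ‖w‖)^2 := by gcongr
    nlinarith [sq_nonneg (‖u‖ - ‖v‖), sq_nonneg (‖u‖ - ‖w‖), sq_nonneg (‖v‖ - ‖w‖)]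
  have hlhs : ‖((1 - ε : ℝ) : ℂ)^m * f3 q X Y Z a b c m n‖^2 = r^m * (q : ℝ)^(2*m) *
      ‖X * b^m * c^n + Y * c^m * a^n + Z * c^m * b^n‖^2 := by
    rw [f3, norm_mul, norm_mul, norm_pow, norm_pow, Complex.norm_real, Complex.norm_natCast,
      Real.norm_eq_abs, abs_of_pos (by linarith), hr]
    have : ((1 - ε)^2)^m = ((1 - ε)^m)^2 := by rw [← pow_mul, ← pow_mul, mul_comm]
    rw [this]
    ring
  rw [hlhs]
  have hw := wt_upper q hq (m, n)
  simp only at hw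
  have hqm : (0 : ℝ) < (q : ℝ)^(2*m) := by positivity
  calc _ ≤ r^m * (q : ℝ)^(2*m) * (3 * ((‖X‖^2 + ‖Z‖^2) * ρ^n + ‖Y‖^2 * ρ^(m-n))) *
        (((q : ℝ) + 1) / (q : ℝ)^(2 * m)) := by
        gcongr
        exact wt_nonneg q hq _
    _ = _ := by field_simp

/-- For `θ ∈ ℝ`, the triple `s = (√q e^{iθ}, e^{-2iθ}, e^{iθ}/√q)` lies in `S`, has pairwise
distinct entries, `f_s^ε ∈ L²_w` for `ε ∈ (0,1/2)`, and the normalized defects for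
`λ⁺ = q^{3/2}e^{iθ} + q e^{-2iθ} + q^{1/2}e^{iθ}`, `λ⁻ = conj λ⁺` tend to `0` as `ε → 0⁺`. -/
theorem approx_eigen_hypocycloid (q : ℕ) (hq2 : 2 ≤ q) (hq : IsPrimePow q)
    (θ : ℝ) (s1 s2 s3 lp lm : ℂ)
    (hs1 : s1 = (Real.sqrt q : ℂ) * Complex.exp (θ * Complex.I))
    (hs2 : s2 = Complex.exp (-(2 * θ) * Complex.I))
    (hs3 : s3 = Complex.exp (θ * Complex.I) / (Real.sqrt q : ℂ))
    (hlp : lp = ((q : ℂ) * (Real.sqrt q : ℂ)) * Complex.exp (θ * Complex.I) +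
      (q : ℂ) * Complex.exp (-(2 * θ) * Complex.I) +
      (Real.sqrt q : ℂ) * Complex.exp (θ * Complex.I))
    (hlm : lm = (starRingEnd ℂ) lp) :
    (s1 * s2 * s3 = 1 ∧
      (starRingEnd ℂ) (s1 + s2 + s3) = s1⁻¹ + s2⁻¹ + s3⁻¹) ∧
    (s1 ≠ s2 ∧ s1 ≠ s3 ∧ s2 ≠ s3) ∧
    (∀ ε : ℝ, ε ∈ Set.Ioo (0 : ℝ) (1/2) → MemL2 q (fse q s1 s2 s3 ε)) ∧
    Filter.Tendsto (fun ε : ℝ =>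
        Real.sqrt (normSqW q (fun m n =>
          Aplus q (fse q s1 s2 s3 ε) m n - lp * fse q s1 s2 s3 ε m n)) /
        Real.sqrt (normSqW q (fse q s1 s2 s3 ε)))
      (nhdsWithin 0 (Set.Ioi 0)) (nhds 0) ∧
    Filter.Tendsto (fun ε : ℝ =>
        Real.sqrt (normSqW q (fun m n =>
          Aminus q (fse q s1 s2 s3 ε) m n - lm * fse q s1 s2 s3 ε m n)) /
        Real.sqrt (normSqW q (fse q s1 s2 s3 ε)))
      (nhdsWithin 0 (Set.Ioi 0)) (nhds 0) := by
  set e : ℂ := Complex.exp (θ * Complex.I) with he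
  set t : ℝ := Real.sqrt q with ht
  have h2 : (2 : ℝ) ≤ q := by exact_mod_cast hq2
  have htt : t * t = q := Real.mul_self_sqrt (by positivity)
  have ht0 : 0 < t := Real.sqrt_pos.2 (by linarith)
  have ht1 : 1 < t := by nlinarith
  have httC : (t : ℂ) * t = q := by exact_mod_cast htt
  have htC : (t : ℂ) ≠ 0 := by exact_mod_cast ht0.ne'
  have he0 : e ≠ 0 := Complex.exp_ne_zero _
  have hen : ‖e‖ = 1 := Complex.norm_exp_ofReal_mul_I θ
  have hce : (starRingEnd ℂ) e = e⁻¹ := (Complex.inv_eq_conj hen).symm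
  have hs2' : Complex.exp (-(2 * θ) * Complex.I) = (e * e)⁻¹ := by
    rw [he, ← Complex.exp_add, ← Complex.exp_neg]; congr 1; ring
  rw [hs2'] at hs2 hlp
  have hct : (starRingEnd ℂ) (t : ℂ) = t := Complex.conj_ofReal t
  have habc : s1 * s2 * s3 = 1 := by rw [hs1, hs2, hs3]; field_simp
  have hconj : (starRingEnd ℂ) (s1 + s2 + s3) = s1⁻¹ + s2⁻¹ + s3⁻¹ := by
    rw [hs1, hs2, hs3]
    simp only [map_add, map_mul, map_inv₀, map_div₀, hce, hct]
    field_simp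
    ring
  have hn1 : ‖s1‖ = t := by
    rw [hs1, norm_mul, hen, Complex.norm_real, Real.norm_eq_abs, abs_of_pos ht0, mul_one]
  have hn2 : ‖s2‖ = 1 := by rw [hs2, norm_inv, norm_mul, hen]; simp
  have hn3 : ‖s3‖ = t⁻¹ := by
    rw [hs3, norm_div, hen, Complex.norm_real, Real.norm_eq_abs, abs_of_pos ht0, one_div]
  have hti : t⁻¹ < 1 := inv_lt_one_of_one_lt₀ ht1
  have h12 : s1 ≠ s2 := by
    intro h; rw [h, hn2] at hn1; linarith
  have h13 : s1 ≠ s3 := by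
    intro h; rw [h, hn3] at hn1; linarith
  have h23 : s2 ≠ s3 := by
    intro h; rw [h, hn3] at hn2; linarith
  have ha : s1 = q * s3 := by
    rw [hs1, hs3, ← httC]; field_simp
  have hlp' : lp = q * (s1 + s2 + s3) := by
    rw [hlp, hs1, hs2, hs3, ← httC]; field_simp
  have z1 : s1 ≠ 0 := by intro h; simp [h] at habc
  have z2 : s2 ≠ 0 := by intro h; simp [h] at habc
  have z3 : s3 ≠ 0 := by intro h; simp [h] at habc
  have hlm' : lm = q * (s1 * s2 + s2 * s3 + s1 * s3) := by
    rw [hlm, hlp', map_mul, hconj, Complex.conj_natCast]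
    have i1 : s1⁻¹ = s2 * s3 := by field_simp; linear_combination -habc
    have i2 : s2⁻¹ = s1 * s3 := by field_simp; linear_combination -habc
    have i3 : s3⁻¹ = s1 * s2 := by field_simp; linear_combination -habc
    rw [i1, i2, i3]; ring
  have heig : IsEigen q (fs q s1 s2 s3) lp lm := by
    rw [hlp', hlm']
    exact fs_eigen q s1 s2 s3 habc ha h12 h13 h23
  have hmem : ∀ ε : ℝ, ε ∈ Set.Ioo (0 : ℝ) (1/2) → MemL2 q (fse q s1 s2 s3 ε) := by
    intro ε hε
    have := f3_mem q hq2 (Bc q s2 s3 s1) (Bc q s3 s1 s2) (Bc q s3 s2 s1) s1 s2 s3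
      (by rw [hn1, sq, htt]) hn2 (by rw [hn3, inv_pow, sq, htt]) ε hε.1 hε.2
    rw [← fs_eq_f3 q s1 s2 s3 ha] at this
    exact this
  have hK : 0 ≤ Kc q := by unfold Kc; positivity
  refine ⟨⟨habc, hconj⟩, ⟨h12, h13, h23⟩, hmem, ?_, ?_⟩
  · refine ratio_tendsto _ _ (4 * Kc q * (2 * ((q : ℝ)^2 + q + 1))^2) (by positivity) ?_
    intro ε hε
    refine le_trans (defect_plus q hq2 _ lp lm heig ε hε.1 hε.2 (hmem ε hε)) (le_of_eq ?_)
    unfold fse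
    ring
  · refine ratio_tendsto _ _ (4 * Kc q * (2 * ((q : ℝ)^2 + q + 1))^2) (by positivity) ?_
    intro ε hε
    refine le_trans (defect_minus q hq2 _ lp lm heig ε hε.1 hε.2 (hmem ε hε)) (le_of_eq ?_)
    unfold fse
    ring
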